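/- arXiv:2603.08378 — 2 statements merged into one kernel-verified Lean document; each statement's English description precedes it below -/
import Mathlib

section
/- Let σ > 0 and let r ∈ (0,1) be irrational with B_σ(r) < +∞ and B_σ(r) ≤ B_σ(x) for every irrational x ∈ (0,1) (r is a global minimizer). Then for every natural number K, B_σ(r) ≥ B_σ^{(K)}(r)/(1 − β_K(r)), where B_σ^{(K)}(r) = Σ_{j=0}^{K} β_{j−1}(r)·(A^j(r))^{−1/σ}. -/
open Real Set MeasureTheory
open scoped ENNReal

/-- The Gauss map `A(x) = 1/x - ⌊1/x⌋`. -/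
noncomputable def gaussMap (x : ℝ) : ℝ := 1 / x - (⌊1 / x⌋ : ℝ)

/-- `brjunoBeta x j = β_{j-1}(x) = ∏_{i=0}^{j-1} A^i(x)`; in particular
`brjunoBeta x 0 = β_{-1}(x) = 1` and `β_K(x) = brjunoBeta x (K+1)`. -/
noncomputable def brjunoBeta (x : ℝ) (j : ℕ) : ℝ := ∏ i ∈ Finset.range j, gaussMap^[i] x

/-- The σ-Brjuno function `B_σ(x) = Σ_{j≥0} β_{j-1}(x) · (A^j x)^{-1/σ}`, valued in `[0,+∞]`. -/
noncomputable def brjuno (σ x : ℝ) : ℝ≥0∞ :=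
  ∑' j : ℕ, ENNReal.ofReal (brjunoBeta x j * (gaussMap^[j] x) ^ (-(1 / σ)))

/-- The K-th partial sum `B_σ^{(K)}(x) = Σ_{j=0}^{K} β_{j-1}(x) · (A^j x)^{-1/σ}`. -/
noncomputable def brjunoPartial (σ x : ℝ) (K : ℕ) : ℝ :=
  ∑ j ∈ Finset.range (K + 1), brjunoBeta x j * (gaussMap^[j] x) ^ (-(1 / σ))

/-- The fixed point `η_m = (√(m²+4) − m)/2 = [0; m, m, m, ...]` of the Gauss map. -/
noncomputable def eta (m : ℕ) : ℝ := (Real.sqrt ((m : ℝ) ^ 2 + 4) - m) / 2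

/-- `b* = (σ+1)^{1+1/σ}/σ`. -/
noncomputable def bstar (σ : ℝ) : ℝ := (σ + 1) ^ (1 + 1 / σ) / σ

/-- The global lower bound `g(x) = x^{-1/σ} + b*·x`. -/
noncomputable def gLow (σ x : ℝ) : ℝ := x ^ (-(1 / σ)) + bstar σ * x

/-- The cylinder lower bound `g_k(x) = x^{-1/σ} + x·(1/x − k)^{-1/σ} + (1 − kx)·b*`. -/
noncomputable def gCyl (σ : ℝ) (k : ℕ) (x : ℝ) : ℝ :=
  x ^ (-(1 / σ)) + x * (1 / x - (k : ℝ)) ^ (-(1 / σ)) + (1 - (k : ℝ) * x) * bstar σ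
/-- The Gauss map preserves the irrational points of the unit interval. -/
theorem gaussMap_irrational_mem_Ioo {x : ℝ} (hx : Irrational x) :
    Irrational (gaussMap x) ∧ gaussMap x ∈ Set.Ioo (0 : ℝ) 1 := by
  have hirr : Irrational (gaussMap x) := by
    unfold gaussMap
    rw [one_div]
    exact (irrational_inv_iff.mpr hx).sub_intCast _
  refine ⟨hirr, lt_of_le_of_ne (Int.fract_nonneg (1 / x)) hirr.ne_zero.symm,
    Int.fract_lt_one (1 / x)⟩

theorem gaussMap_iterate_irrational_mem_Ioo {x : ℝ} (hx : Irrational x)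
    (hx01 : x ∈ Set.Ioo (0 : ℝ) 1) (n : ℕ) :
    Irrational (gaussMap^[n] x) ∧ gaussMap^[n] x ∈ Set.Ioo (0 : ℝ) 1 := by
  induction n with
  | zero => exact ⟨hx, hx01⟩
  | succ n ih =>
    rw [Function.iterate_succ_apply']
    exact gaussMap_irrational_mem_Ioo ih.1

theorem brjunoBeta_pos {x : ℝ} (hx : Irrational x) (hx01 : x ∈ Set.Ioo (0 : ℝ) 1) (n : ℕ) :
    0 < brjunoBeta x n :=
  Finset.prod_pos fun i _ => (gaussMap_iterate_irrational_mem_Ioo hx hx01 i).2.1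

theorem brjunoBeta_succ_lt_one {x : ℝ} (hx : Irrational x) (hx01 : x ∈ Set.Ioo (0 : ℝ) 1)
    (n : ℕ) : brjunoBeta x (n + 1) < 1 := by
  have h := gaussMap_iterate_irrational_mem_Ioo hx hx01
  rw [brjunoBeta, Finset.prod_range_succ]
  exact mul_lt_one_of_nonneg_of_lt_one_right
    (Finset.prod_le_one (fun i _ => (h i).2.1.le) fun i _ => (h i).2.2.le) (h n).2.1.le (h n).2.2

theorem brjunoBeta_add (x : ℝ) (m n : ℕ) :
    brjunoBeta x (m + n) = brjunoBeta x m * brjunoBeta (gaussMap^[m] x) n := by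
  simp only [brjunoBeta, Finset.prod_range_add, ← Function.iterate_add_apply, add_comm]

/-- The iterated functional equation
`B_σ(x) = B_σ^{(K)}(x) + β_K(x) · B_σ(A^{K+1} x)`. -/
theorem brjuno_eq_brjunoPartial_add (σ : ℝ) {x : ℝ} (hx : Irrational x)
    (hx01 : x ∈ Set.Ioo (0 : ℝ) 1) (K : ℕ) :
    brjuno σ x = ENNReal.ofReal (brjunoPartial σ x K) +
      ENNReal.ofReal (brjunoBeta x (K + 1)) * brjuno σ (gaussMap^[K + 1] x) := by
  have hβ := brjunoBeta_pos hx hx01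
  have hA := gaussMap_iterate_irrational_mem_Ioo hx hx01
  have hsplit := Summable.sum_add_tsum_nat_add' (k := K + 1) (f := fun j => ENNReal.ofReal
    (brjunoBeta x j * (gaussMap^[j] x) ^ (-(1 / σ)))) ENNReal.summable
  have hhead : ENNReal.ofReal (brjunoPartial σ x K) = ∑ j ∈ Finset.range (K + 1),
      ENNReal.ofReal (brjunoBeta x j * (gaussMap^[j] x) ^ (-(1 / σ))) :=
    ENNReal.ofReal_sum_of_nonneg
      fun i _ => mul_nonneg (hβ i).le (Real.rpow_nonneg (hA i).2.1.le _)
  have htail : ENNReal.ofReal (brjunoBeta x (K + 1)) * brjuno σ (gaussMap^[K + 1] x) =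
      ∑' j, ENNReal.ofReal
        (brjunoBeta x (j + (K + 1)) * (gaussMap^[j + (K + 1)] x) ^ (-(1 / σ))) := by
    generalize K + 1 = N
    rw [brjuno, ← ENNReal.tsum_mul_left]
    refine tsum_congr fun j => ?_
    rw [← ENNReal.ofReal_mul (hβ N).le, Function.iterate_add_apply, add_comm j N,
      brjunoBeta_add, mul_assoc]
  rw [hhead, htail, hsplit, brjuno]

/-- if `r` is a global minimizer of `B_σ`, then for every `K`,
`B_σ(r) ≥ B_σ^{(K)}(r)/(1 − β_K(r))`. -/
theorem brjuno_min_lower_bound (σ : ℝ) (hσ : 0 < σ) (r : ℝ) (hr : Irrational r)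
    (hr01 : r ∈ Set.Ioo (0 : ℝ) 1) (hfin : brjuno σ r < ⊤)
    (hmin : ∀ x : ℝ, Irrational x → x ∈ Set.Ioo (0 : ℝ) 1 → brjuno σ r ≤ brjuno σ x)
    (K : ℕ) :
    ENNReal.ofReal (brjunoPartial σ r K / (1 - brjunoBeta r (K + 1))) ≤ brjuno σ r := by
  have hA := gaussMap_iterate_irrational_mem_Ioo hr hr01 (K + 1)
  have hβ := brjunoBeta_pos hr hr01 (K + 1)
  have hβ1 := brjunoBeta_succ_lt_one hr hr01 K
  have hle : ENNReal.ofReal (brjunoPartial σ r K) +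
      ENNReal.ofReal (brjunoBeta r (K + 1)) * brjuno σ r ≤ brjuno σ r := by
    conv_rhs => rw [brjuno_eq_brjunoPartial_add σ hr hr01 K]
    gcongr
    exact hmin _ hA.1 hA.2
  have hP : 0 ≤ brjunoPartial σ r K := Finset.sum_nonneg fun i _ =>
    mul_nonneg (brjunoBeta_pos hr hr01 i).le
      (Real.rpow_nonneg (gaussMap_iterate_irrational_mem_Ioo hr hr01 i).2.1.le _)
  rw [← ENNReal.ofReal_toReal hfin.ne] at hle ⊢
  rw [← ENNReal.ofReal_mul hβ.le,
    ← ENNReal.ofReal_add hP (mul_nonneg hβ.le ENNReal.toReal_nonneg),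
    ENNReal.ofReal_le_ofReal_iff ENNReal.toReal_nonneg] at hle
  refine ENNReal.ofReal_le_ofReal ((div_le_iff₀ (sub_pos.mpr hβ1)).mpr ?_)
  linarith
end

section
/- Let n be a positive integer, η_{n+1} = (√((n+1)²+4) − (n+1))/2, and let σ > 0 satisfy σ < n + η_{n+1}. Suppose r is an irrational number with 0 < r ≤ 1/(n+1), B_σ(r) < +∞, and B_σ(r) ≤ B_σ(x) for every irrational x ∈ (0,1). Then r ≥ η_{n+1}. -/
open Real Set MeasureTheory
open scoped ENNReal

theorem gaussMap_eq_fract (x : ℝ) : gaussMap x = Int.fract (1 / x) := rfl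

theorem irrational_gaussMap {x : ℝ} (hx : Irrational x) : Irrational (gaussMap x) := by
  have h : Irrational (1 / x) := by simpa using hx.inv
  exact h.sub_intCast _

theorem gaussMap_mem_Ioo {x : ℝ} (hx : Irrational x) : gaussMap x ∈ Set.Ioo (0 : ℝ) 1 :=
  ⟨lt_of_le_of_ne (Int.fract_nonneg (1 / x)) (irrational_gaussMap hx).ne_zero.symm,
    Int.fract_lt_one (1 / x)⟩

theorem brjunoBeta_succ (x : ℝ) (j : ℕ) :
    brjunoBeta x (j + 1) = x * brjunoBeta (gaussMap x) j := by
  simp [brjunoBeta, Finset.prod_range_succ', mul_comm]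

/-- The functional equation `B_σ(x) = x^{-1/σ} + x · B_σ(A x)`. -/
theorem brjuno_eq_add_mul (σ : ℝ) {x : ℝ} (hx : 0 ≤ x) :
    brjuno σ x = ENNReal.ofReal (x ^ (-(1 / σ))) + ENNReal.ofReal x * brjuno σ (gaussMap x) := by
  rw [brjuno, tsum_eq_zero_add' ENNReal.summable, brjuno, ← ENNReal.tsum_mul_left]
  congr 1
  · simp [brjunoBeta]
  · refine tsum_congr fun j => ?_
    rw [brjunoBeta_succ, mul_assoc, ENNReal.ofReal_mul hx, Function.iterate_succ_apply]

/-- At a fixed point of the Gauss map the Brjuno series is geometric. -/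
theorem brjuno_of_gaussMap_eq (σ : ℝ) {x : ℝ} (hx0 : 0 < x) (hx1 : x < 1)
    (hfix : gaussMap x = x) :
    brjuno σ x = ENNReal.ofReal ((1 - x)⁻¹ * x ^ (-(1 / σ))) := by
  have hiter : ∀ j : ℕ, gaussMap^[j] x = x := Function.iterate_fixed hfix
  have hsum := (hasSum_geometric_of_lt_one hx0.le hx1).mul_right (x ^ (-(1 / σ)))
  rw [← hsum.tsum_eq, ENNReal.ofReal_tsum_of_nonneg (fun j => by positivity) hsum.summable]
  simp [brjuno, brjunoBeta, hiter]

theorem eta_sq (m : ℕ) : eta m * (m + eta m) = 1 := by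
  have h := Real.sq_sqrt (show (0 : ℝ) ≤ (m : ℝ) ^ 2 + 4 by positivity)
  unfold eta
  nlinarith

theorem eta_pos (m : ℕ) : 0 < eta m := by
  have h : (m : ℝ) < Real.sqrt ((m : ℝ) ^ 2 + 4) := Real.lt_sqrt_of_sq_lt (by linarith)
  unfold eta
  linarith

theorem eta_lt_one {m : ℕ} (hm : 0 < m) : eta m < 1 := by
  have h1 : (1 : ℝ) ≤ m := by exact_mod_cast hm
  nlinarith [eta_sq m, eta_pos m]

theorem gaussMap_eta {m : ℕ} (hm : 0 < m) : gaussMap (eta m) = eta m := by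
  have h : 1 / eta m = eta m + m := by
    rw [div_eq_iff (eta_pos m).ne']
    linarith [eta_sq m]
  rw [gaussMap_eq_fract, h, Int.fract_add_natCast]
  exact Int.fract_eq_self.2 ⟨(eta_pos m).le, eta_lt_one hm⟩

theorem irrational_eta {m : ℕ} (hm : 2 ≤ m) : Irrational (eta m) := by
  have h : Irrational (Real.sqrt ((m ^ 2 + 4 : ℕ) : ℝ)) := by
    rw [irrational_sqrt_natCast_iff]
    rintro ⟨k, hk⟩
    have h1 : m < k := by nlinarith
    nlinarith
  push_cast at h
  simpa [eta] using (h.sub_natCast m).div_natCast (two_ne_zero)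

/-- The function `x ↦ x^{-1/σ} / (1 - x)` decreases strictly on `(0, 1/(σ+1))`. -/
theorem rpow_mul_one_sub_lt {σ x y : ℝ} (hσ : 0 < σ) (hx : 0 < x) (hxy : x < y) (hy : y < 1)
    (hσy : σ * y < 1 - y) :
    y ^ (-(1 / σ)) * (1 - x) < x ^ (-(1 / σ)) * (1 - y) := by
  have hy0 : 0 < y := hx.trans hxy
  have hy1 : 0 < 1 - y := by linarith
  have hx1 : 0 < 1 - x := by linarith
  rw [← Real.log_lt_log_iff (by positivity) (by positivity),
    Real.log_mul (by positivity) hx1.ne', Real.log_mul (by positivity) hy1.ne',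
    Real.log_rpow hx, Real.log_rpow hy0]
  have h1 := Real.log_le_sub_one_of_pos (div_pos hx hy0)
  have h2 := Real.log_le_sub_one_of_pos (div_pos hx1 hy1)
  rw [Real.log_div hx.ne' hy0.ne'] at h1
  rw [Real.log_div hx1.ne' hy1.ne'] at h2
  have h3 : (1 - x) / (1 - y) - 1 < 1 / σ * (1 - x / y) := by
    have e1 : (1 - x) / (1 - y) - 1 = (y - x) / (1 - y) := by field_simp; ring
    have e2 : 1 / σ * (1 - x / y) = (y - x) / (σ * y) := by field_simp
    rw [e1, e2]
    exact div_lt_div_of_pos_left (by linarith) (by positivity) hσy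
  have h4 : 1 / σ * (1 - x / y) ≤ 1 / σ * (Real.log y - Real.log x) :=
    mul_le_mul_of_nonneg_left (by linarith) (by positivity)
  linarith

/-- under the hypotheses of Proposition `MT`, the minimizer satisfies
`r ≥ η_{n+1}`. -/
theorem brjuno_minimizer_ge_eta (n : ℕ) (hn : 0 < n) (σ : ℝ) (hσ : 0 < σ)
    (hσn : σ < n + eta (n + 1)) (r : ℝ) (hr : Irrational r) (hr0 : 0 < r)
    (hr1 : r ≤ 1 / ((n : ℝ) + 1)) (hfin : brjuno σ r < ⊤)
    (hmin : ∀ x : ℝ, Irrational x → x ∈ Set.Ioo (0 : ℝ) 1 → brjuno σ r ≤ brjuno σ x) :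
    eta (n + 1) ≤ r := by
  by_contra! hlt
  have hη0 := eta_pos (n + 1)
  have hη1 := eta_lt_one n.succ_pos
  have hση : σ * eta (n + 1) < 1 - eta (n + 1) := by
    have h := eta_sq (n + 1)
    push_cast at h
    nlinarith
  have hstrict := rpow_mul_one_sub_lt hσ hr0 hlt hη1 hση
  have hupper : (brjuno σ r).toReal * (1 - eta (n + 1)) ≤ eta (n + 1) ^ (-(1 / σ)) := by
    have h := hmin _ (irrational_eta (by omega : 2 ≤ n + 1)) ⟨hη0, hη1⟩
    rw [brjuno_of_gaussMap_eq σ hη0 hη1 (gaussMap_eta n.succ_pos)] at h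
    have h' := ENNReal.toReal_le_of_le_ofReal
      (mul_nonneg (inv_nonneg.2 (by linarith)) (by positivity)) h
    rwa [inv_mul_eq_div, le_div_iff₀ (by linarith)] at h'
  have hlower : r ^ (-(1 / σ)) ≤ (brjuno σ r).toReal * (1 - r) := by
    have h : ENNReal.ofReal (r ^ (-(1 / σ))) + ENNReal.ofReal r * brjuno σ r ≤ brjuno σ r := by
      conv_rhs => rw [brjuno_eq_add_mul σ hr0.le]
      gcongr
      exact hmin _ (irrational_gaussMap hr) (gaussMap_mem_Ioo hr)
    have h' := ENNReal.toReal_mono hfin.ne h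
    rw [ENNReal.toReal_add ENNReal.ofReal_ne_top (ENNReal.mul_ne_top ENNReal.ofReal_ne_top hfin.ne),
      ENNReal.toReal_mul, ENNReal.toReal_ofReal (by positivity), ENNReal.toReal_ofReal hr0.le] at h'
    linarith
  have h1 := mul_le_mul_of_nonneg_right hlower (show 0 ≤ 1 - eta (n + 1) by linarith)
  have h2 := mul_le_mul_of_nonneg_right hupper (show 0 ≤ 1 - r by linarith)
  linarith
end
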